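/- Let N ≥ 1 be an integer, θ ∈ (0,2), p = 1 + θ/N, and T ∈ (0,∞). There exists a constant γ > 0 depending only on N and θ such that: if μ is a nonnegative Radon measure on ℝ^N and there exists a very weak supersolution u of ∂_t u + (−Δ)^{θ/2} u = u^p with initial data μ on ℝ^N × [0,T), then μ(B(z,σ)) ≤ γ [log(e + T^{1/θ}/σ)]^{−N/θ} for every z ∈ ℝ^N and every σ ∈ (0, T^{1/θ}). -/

import Mathlib

open MeasureTheory Real Set

/-- The fractional Laplacian `(-Δ)^{θ/2}` of `φ : ℝ^N → ℝ` at `x`, defined via the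
absolutely convergent second-difference integral with the standard normalizing
constant `A(N,θ)`. -/
noncomputable def fracLap (N : ℕ) (θ : ℝ) (φ : EuclideanSpace ℝ (Fin N) → ℝ)
    (x : EuclideanSpace ℝ (Fin N)) : ℝ :=
  (Real.Gamma ((N + θ) / 2) / (Real.pi ^ ((N : ℝ) / 2) * Real.Gamma (2 - θ / 2))
      * (θ / 2) * (1 - θ / 2)) / 2 *
    ∫ z : EuclideanSpace ℝ (Fin N),
      (2 * φ x - φ (x + z) - φ (x - z)) * ‖z‖ ^ (-(N : ℝ) - θ)

/-- `u` is a very weak supersolution of `∂_t u + (-Δ)^{θ/2} u = u^p` with initial data `μ`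
on `ℝ^N × [0,T)`. -/
def IsVeryWeakSupersolutionFrac (N : ℕ) (θ p T : ℝ)
    (μ : Measure (EuclideanSpace ℝ (Fin N)))
    (u : EuclideanSpace ℝ (Fin N) → ℝ → ℝ) : Prop :=
  Measurable (Function.uncurry u) ∧
  (∀ x : EuclideanSpace ℝ (Fin N), ∀ t ∈ Set.Ioo (0:ℝ) T, 0 ≤ u x t) ∧
  (∀ K : Set (EuclideanSpace ℝ (Fin N)), IsCompact K → ∀ T' ∈ Set.Ioo (0:ℝ) T,
    IntegrableOn (Function.uncurry u) (K ×ˢ Set.Ioo (0:ℝ) T') ∧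
    IntegrableOn (fun q : EuclideanSpace ℝ (Fin N) × ℝ => u q.1 q.2 ^ p)
      (K ×ˢ Set.Ioo (0:ℝ) T')) ∧
  ∀ τ ∈ Set.Ioo (0:ℝ) T, ∀ φ : EuclideanSpace ℝ (Fin N) → ℝ → ℝ,
    ContDiff ℝ (⊤ : ℕ∞) (Function.uncurry φ) →
    HasCompactSupport (Function.uncurry φ) →
    (∀ x t, 0 ≤ φ x t) →
    (∀ x, φ x τ = 0) →
    (∫ t in Set.Ioo (0:ℝ) τ, ∫ x,
        u x t * (-(deriv (φ x) t) + fracLap N θ (fun y => φ y t) x)) ≥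
      (∫ t in Set.Ioo (0:ℝ) τ, ∫ x, u x t ^ p * φ x t) + ∫ x, φ x 0 ∂μ

/-- The ambient Euclidean space. -/
abbrev EN (N : ℕ) := EuclideanSpace ℝ (Fin N)

theorem aux_second_diff {N : ℕ} {f : EN N → ℝ} (hf : ContDiff ℝ (⊤ : ℕ∞) f)
    (hc : HasCompactSupport f) :
    ∃ C : ℝ, 0 ≤ C ∧ ∀ x z, |2 * f x - f (x + z) - f (x - z)| ≤ C * min 1 (‖z‖ ^ 2) := by
  obtain ⟨M, hM⟩ := hc.exists_bound_of_continuous hf.continuous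
  have hd : ContDiff ℝ (⊤ : ℕ∞) (fderiv ℝ f) := hf.fderiv_right (by norm_cast)
  obtain ⟨L, hL⟩ := ContDiff.lipschitzWith_of_hasCompactSupport (hc.fderiv (𝕜 := ℝ)) hd (by simp)
  have hdiff : Differentiable ℝ f := hf.differentiable (by simp)
  refine ⟨max (4 * M) L, le_max_of_le_right L.2, fun x z => ?_⟩
  have hM0 : 0 ≤ M := (norm_nonneg _).trans (hM 0)
  have h1 : |2 * f x - f (x + z) - f (x - z)| ≤ 4 * M := by
    have a := abs_le.1 (hM x); have b := abs_le.1 (hM (x+z)); have c := abs_le.1 (hM (x-z))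
    rw [abs_le]; constructor <;> linarith [a.1, a.2, b.1, b.2, c.1, c.2]
  have h2 : |2 * f x - f (x + z) - f (x - z)| ≤ L * ‖z‖ ^ 2 := by
    have key := Convex.norm_image_sub_le_of_norm_fderiv_le (𝕜 := ℝ) (f := fun w => f (w + z) - f w)
      (C := L * ‖z‖) (s := Set.univ) (x := x - z) (y := x)
      (fun w _ => by
        have := hdiff.differentiableAt (x := w + z)
        have := hdiff.differentiableAt (x := w)
        fun_prop)
      (fun w _ => by
        have hd1 : DifferentiableAt ℝ (fun w => f (w + z)) w := by
          have := hdiff.differentiableAt (x := w + z)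
          fun_prop
        rw [fderiv_fun_sub hd1 hdiff.differentiableAt]
        rw [fderiv_comp_add_right]
        have := hL.norm_sub_le (w + z) w
        simpa using this) convex_univ (Set.mem_univ _) (Set.mem_univ _)
    simp only [sub_add_cancel, sub_sub_cancel, Real.norm_eq_abs] at key
    rw [← abs_neg]
    calc _ = |f (x + z) - f x - (f x - f (x - z))| := by congr 1; ring
      _ ≤ _ := key
      _ = _ := by ring
  rcases le_total 1 (‖z‖^2) with h | h
  · rw [min_eq_left h, mul_one]; exact h1.trans (le_max_left _ _)
  · rw [min_eq_right h]; exact h2.trans (by gcongr; exact le_max_right _ _)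

theorem aux_kernel_integrable {N : ℕ} (hN : 1 ≤ N) {θ : ℝ} (hθ : θ ∈ Set.Ioo (0:ℝ) 2) :
    Integrable (fun z : EN N => min 1 (‖z‖ ^ 2) * ‖z‖ ^ (-(N : ℝ) - θ)) := by
  have : Nonempty (Fin N) := ⟨⟨0, hN⟩⟩
  obtain ⟨h0, h2⟩ := hθ
  rw [integrable_fun_norm_addHaar volume (f := fun r : ℝ => min 1 (r ^ 2) * r ^ (-(N : ℝ) - θ))]
  simp only [finrank_euclideanSpace, Fintype.card_fin, smul_eq_mul]
  have e : ∀ r : ℝ, 0 < r → r ^ (N - 1) * r ^ (-(N : ℝ) - θ) = r ^ (-1 - θ) := by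
    intro r hr
    rw [← Real.rpow_natCast, ← Real.rpow_add hr]
    congr 1; push_cast [hN]; ring
  rw [← Set.Ioc_union_Ioi_eq_Ioi (zero_le_one (α := ℝ))]
  refine IntegrableOn.union ?_ ?_
  · have := (intervalIntegral.intervalIntegrable_rpow' (a := 0) (b := 1) (r := 1 - θ) (by linarith))
    rw [intervalIntegrable_iff_integrableOn_Ioc_of_le zero_le_one] at this
    refine this.congr_fun ?_ measurableSet_Ioc
    intro r hr
    have hr2 : r ^ 2 ≤ 1 := pow_le_one₀ hr.1.le hr.2
    simp only [min_eq_right hr2]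
    calc r ^ (1 - θ) = r ^ (2:ℕ) * r ^ (-1 - θ) := by
          rw [← Real.rpow_natCast r 2, ← Real.rpow_add hr.1]; congr 1; push_cast; ring
      _ = _ := by rw [← e r hr.1]; ring
  · refine (integrableOn_Ioi_rpow_of_lt (a := -1 - θ) (by linarith) zero_lt_one).congr_fun ?_ measurableSet_Ioi
    intro r hr
    have hr : 1 < r := hr
    have hr2 : 1 ≤ r ^ 2 := one_le_pow₀ hr.le
    simp only [min_eq_left hr2]
    rw [← e r (by linarith)]; ring

theorem aux_fl_integrable {N : ℕ} (hN : 1 ≤ N) {θ : ℝ} (hθ : θ ∈ Set.Ioo (0:ℝ) 2)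
    {f : EN N → ℝ} (hf : ContDiff ℝ (⊤ : ℕ∞) f) (hc : HasCompactSupport f) (x : EN N) :
    Integrable (fun z : EN N => (2 * f x - f (x + z) - f (x - z)) * ‖z‖ ^ (-(N : ℝ) - θ)) := by
  obtain ⟨C, hC0, hC⟩ := aux_second_diff hf hc
  refine ((aux_kernel_integrable hN hθ).const_mul C).mono' ?_ ?_
  · have := hf.continuous
    refine Measurable.aestronglyMeasurable ?_
    have h1 : Continuous (fun z : EN N => 2 * f x - f (x + z) - f (x - z)) := by fun_prop
    exact h1.measurable.mul (measurable_norm.pow_const _)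
  · refine Filter.Eventually.of_forall fun z => ?_
    rw [norm_mul, Real.norm_eq_abs, Real.norm_of_nonneg (Real.rpow_nonneg (norm_nonneg _) _), ← mul_assoc]
    exact mul_le_mul_of_nonneg_right (hC x z) (Real.rpow_nonneg (norm_nonneg _) _)

theorem aux_const_nonneg {N : ℕ} (hN : 1 ≤ N) {θ : ℝ} (hθ : θ ∈ Set.Ioo (0:ℝ) 2) :
    0 ≤ (Real.Gamma ((N + θ) / 2) / (Real.pi ^ ((N : ℝ) / 2) * Real.Gamma (2 - θ / 2))
      * (θ / 2) * (1 - θ / 2)) / 2 := by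
  obtain ⟨h0, h2⟩ := hθ
  have a := Real.Gamma_pos_of_pos (s := (N + θ) / 2) (by positivity)
  have b := Real.Gamma_pos_of_pos (s := 2 - θ / 2) (by linarith)
  have : 0 ≤ 1 - θ / 2 := by linarith
  positivity

theorem aux_fl_bound {N : ℕ} (hN : 1 ≤ N) {θ : ℝ} (hθ : θ ∈ Set.Ioo (0:ℝ) 2)
    {f : EN N → ℝ} (hf : ContDiff ℝ (⊤ : ℕ∞) f) (hc : HasCompactSupport f) :
    ∃ B : ℝ, 0 ≤ B ∧ ∀ x, fracLap N θ f x ≤ B := by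
  obtain ⟨C, hC0, hC⟩ := aux_second_diff hf hc
  refine ⟨(Real.Gamma ((N + θ) / 2) / (Real.pi ^ ((N : ℝ) / 2) * Real.Gamma (2 - θ / 2))
      * (θ / 2) * (1 - θ / 2)) / 2 *
      ∫ z : EN N, C * (min 1 (‖z‖ ^ 2) * ‖z‖ ^ (-(N : ℝ) - θ)), ?_, fun x => ?_⟩
  · refine mul_nonneg (aux_const_nonneg hN hθ) (integral_nonneg fun z => ?_)
    have := Real.rpow_nonneg (norm_nonneg z) (-(N : ℝ) - θ)
    simp only [Pi.zero_apply]
    positivity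
  · refine mul_le_mul_of_nonneg_left ?_ (aux_const_nonneg hN hθ)
    refine integral_mono (aux_fl_integrable hN hθ hf hc x) ((aux_kernel_integrable hN hθ).const_mul C) fun z => ?_
    simp only
    rw [← mul_assoc]
    exact mul_le_mul_of_nonneg_right ((le_abs_self _).trans (hC x z)) (Real.rpow_nonneg (norm_nonneg _) _)

theorem aux_fl_const_mul {N : ℕ} {θ : ℝ} (c : ℝ) (f : EN N → ℝ) (x : EN N) :
    fracLap N θ (fun y => c * f y) x = c * fracLap N θ f x := by
  unfold fracLap
  have : ∀ z : EN N, (2 * (c * f x) - c * f (x + z) - c * f (x - z)) * ‖z‖ ^ (-(N : ℝ) - θ)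
    = c * ((2 * f x - f (x + z) - f (x - z)) * ‖z‖ ^ (-(N : ℝ) - θ)) := fun z => by ring
  simp_rw [this]
  rw [integral_const_mul]; ring

theorem aux_fl_scale {N : ℕ} {θ : ℝ} {R : ℝ} (hR : 0 < R) (z : EN N) (f : EN N → ℝ) (x : EN N) :
    fracLap N θ (fun y => f (R⁻¹ • (y - z))) x = R ^ (-θ) * fracLap N θ f (R⁻¹ • (x - z)) := by
  unfold fracLap
  have key := Measure.integral_comp_inv_smul volume
    (fun w : EN N => (2 * f (R⁻¹ • (x - z)) - f (R⁻¹ • (x - z) + w) - f (R⁻¹ • (x - z) - w))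
      * ‖w‖ ^ (-(N : ℝ) - θ)) R
  simp only [finrank_euclideanSpace, Fintype.card_fin, smul_eq_mul] at key
  have e : ∀ w : EN N, (2 * f (R⁻¹ • (x - z)) - f (R⁻¹ • (x + w - z)) - f (R⁻¹ • (x - w - z)))
      * ‖w‖ ^ (-(N : ℝ) - θ) = R ^ (-(N : ℝ) - θ) *
      ((2 * f (R⁻¹ • (x - z)) - f (R⁻¹ • (x - z) + R⁻¹ • w) - f (R⁻¹ • (x - z) - R⁻¹ • w))
      * ‖R⁻¹ • w‖ ^ (-(N : ℝ) - θ)) := by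
    intro w
    have a1 : R⁻¹ • (x + w - z) = R⁻¹ • (x - z) + R⁻¹ • w := by rw [← smul_add]; congr 1; abel
    have a2 : R⁻¹ • (x - w - z) = R⁻¹ • (x - z) - R⁻¹ • w := by rw [← smul_sub]; congr 1; abel
    have a3 : ‖w‖ ^ (-(N : ℝ) - θ) = R ^ (-(N : ℝ) - θ) * ‖R⁻¹ • w‖ ^ (-(N : ℝ) - θ) := by
      rw [← Real.mul_rpow hR.le (norm_nonneg _), norm_smul, Real.norm_of_nonneg (by positivity),
        mul_inv_cancel_left₀ hR.ne']
    rw [a1, a2, a3]; ring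
  simp_rw [e]
  rw [integral_const_mul, key, abs_of_nonneg (by positivity)]
  have : R ^ (-(N : ℝ) - θ) * R ^ N = R ^ (-θ) := by
    rw [← Real.rpow_natCast, ← Real.rpow_add hR]; congr 1; ring
  rw [← this]; ring

theorem aux_pow_convex (m : ℕ) {a b : ℝ} (ha : 0 ≤ a) (hb : 0 ≤ b) :
    b ^ (m+1) - a ^ (m+1) ≤ (m+1) * b ^ m * (b - a) := by
  induction m with
  | zero => simp
  | succ k ih =>
    have h1 := mul_le_mul_of_nonneg_left ih ha
    have h2 : 0 ≤ (k+1) * b ^ k * (b - a)^2 := by positivity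
    push_cast
    have e1 : b ^ (k+1+1) = b ^ k * b^2 := by ring
    have e2 : a ^ (k+1+1) = a * a ^ (k+1) := by ring
    have e3 : b ^ (k+1) = b ^ k * b := by ring
    rw [e1, e2, e3]; rw [e3] at h1
    nlinarith

theorem aux_fl_pow {N : ℕ} (hN : 1 ≤ N) {θ : ℝ} (hθ : θ ∈ Set.Ioo (0:ℝ) 2)
    {f : EN N → ℝ} (hf : ContDiff ℝ (⊤ : ℕ∞) f) (hc : HasCompactSupport f) (h0 : ∀ x, 0 ≤ f x)
    (m : ℕ) (x : EN N) :
    fracLap N θ (fun y => f y ^ (m+1)) x ≤ (m+1) * f x ^ m * fracLap N θ f x := by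
  have hcp : HasCompactSupport (fun y => f y ^ (m+1)) :=
    hc.comp_left (g := fun r : ℝ => r ^ (m+1)) (by simp)
  have i1 := aux_fl_integrable hN hθ (hf.pow (m+1)) hcp x
  have i2 := (aux_fl_integrable hN hθ hf hc x).const_mul ((m+1) * f x ^ m)
  have := mul_le_mul_of_nonneg_left (integral_mono i1 i2 fun z => by
    simp only
    rw [← mul_assoc]
    refine mul_le_mul_of_nonneg_right ?_ (Real.rpow_nonneg (norm_nonneg _) _)
    have a1 := aux_pow_convex m (h0 (x+z)) (h0 x)
    have a2 := aux_pow_convex m (h0 (x-z)) (h0 x)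
    linarith) (aux_const_nonneg hN hθ)
  unfold fracLap
  refine this.trans (le_of_eq ?_)
  rw [integral_const_mul]; ring

theorem aux_bern {s q : ℝ} (hs : -1 < s) (hq : q ≤ 0) : 1 + q * s ≤ (1 + s) ^ q := by
  have h : 0 < 1 + s := by linarith
  rw [Real.rpow_def_of_pos h]
  have h1 := Real.add_one_le_exp (Real.log (1 + s) * q)
  have h2 := Real.log_le_sub_one_of_pos h
  nlinarith

/-- numeric iteration lemma -/
theorem aux_iter {p C c m : ℝ} (hp : 1 < p) (hC : 0 < C) (hc : 0 < c) (hc1 : c ≤ 1) (hm : 0 < m)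
    {n : ℕ} {Z a : ℕ → ℝ} (hZ0 : 0 ≤ Z 0) (ha : ∀ k < n, 0 ≤ a k)
    (hZ : ∀ k < n, Z k + c * a k ≤ Z (k+1))
    (h : ∀ k < n, m + Z k + a k ≤ C * a k ^ (1/p)) :
    n * ((p - 1) * (c * C ^ (-p))) ≤ m ^ (-(p-1)) := by
  let V : ℕ → ℝ := fun k => m + c * ∑ i ∈ Finset.range k, a i
  have hVZ : ∀ k ≤ n, V k ≤ m + Z k := by
    intro k
    induction k with
    | zero => intro _; simpa [V] using hZ0
    | succ k ih =>
      intro hk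
      have := ih (by omega); have := hZ k (by omega)
      simp only [V, Finset.sum_range_succ] at *
      linarith
  have hmain : ∀ k ≤ n, k * ((p - 1) * (c * C ^ (-p))) ≤ m ^ (-(p-1)) - V k ^ (-(p-1)) ∧ m ≤ V k := by
    intro k
    induction k with
    | zero => intro _; simp [V]
    | succ k ih =>
      intro hk
      obtain ⟨ih1, ih2⟩ := ih (by omega)
      have hak := ha k (by omega)
      have hVs : V (k+1) = V k + c * a k := by simp only [V, Finset.sum_range_succ]; ring
      have hVm : m ≤ V (k+1) := by rw [hVs]; nlinarith
      refine ⟨?_, hVm⟩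
      have hVk : 0 < V k := by linarith
      have hVpos : 0 < V (k+1) := by linarith
      have h1 : V (k+1) ≤ C * a k ^ (1/p) := by
        refine le_trans ?_ (h k (by omega))
        rw [hVs]; have := hVZ k (by omega); nlinarith
      have h2 : V (k+1) ^ p ≤ C ^ p * a k := by
        calc V (k+1) ^ p ≤ (C * a k ^ (1/p)) ^ p := Real.rpow_le_rpow hVpos.le h1 (by linarith)
          _ = _ := by
            rw [Real.mul_rpow hC.le (by positivity), ← Real.rpow_mul hak, one_div_mul_cancel (by linarith), Real.rpow_one]
      have h3 : C ^ (-p) ≤ a k * V (k+1) ^ (-p) := by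
        rw [Real.rpow_neg hC.le, Real.rpow_neg hVpos.le, ← div_eq_mul_inv, le_div_iff₀ (by positivity),
          inv_mul_le_iff₀ (by positivity)]
        exact h2
      -- convexity via Bernoulli
      have h4 : (p-1) * V (k+1) ^ (-p) * (c * a k) ≤ V k ^ (-(p-1)) - V (k+1) ^ (-(p-1)) := by
        have hb := aux_bern (s := - (c * a k) / V (k+1)) (q := -(p-1)) (by
          rw [lt_div_iff₀ hVpos]; linarith) (by linarith)
        have e1 : 1 + - (c * a k) / V (k+1) = V k / V (k+1) := by
          field_simp; rw [hVs]; ring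
        rw [e1, Real.div_rpow hVk.le hVpos.le, le_div_iff₀ (by positivity)] at hb
        have e2 : V (k+1) ^ (-p) = V (k+1) ^ (-(p-1)) / V (k+1) := by
          rw [← Real.rpow_sub_one hVpos.ne']; congr 1; ring
        rw [e2]
        have e3 : (p-1) * (V (k+1) ^ (-(p-1)) / V (k+1)) * (c * a k)
          = (-(p-1) * (- (c * a k) / V (k+1))) * V (k+1) ^ (-(p-1)) := by ring
        rw [e3]; linarith
      have h5 : (p - 1) * (c * C ^ (-p)) ≤ (p-1) * V (k+1) ^ (-p) * (c * a k) := by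
        calc (p - 1) * (c * C ^ (-p)) ≤ (p-1) * (c * (a k * V (k+1) ^ (-p))) := by
              have : 0 ≤ p - 1 := by linarith
              gcongr
          _ = _ := by ring
      push_cast
      linarith
  obtain ⟨h1, h2⟩ := hmain n le_rfl
  have : 0 ≤ V n ^ (-(p-1)) := Real.rpow_nonneg (by linarith) _
  linarith

theorem aux_test {N : ℕ} (hN : 1 ≤ N) {θ : ℝ} (hθ : θ ∈ Set.Ioo (0:ℝ) 2) {p : ℝ} (hp : 1 < p) :
    ∃ K κ : ℝ, 0 < K ∧ 0 ≤ κ ∧ ∀ R : ℝ, 0 < R → ∀ z : EN N, ∃ φ : EN N → ℝ → ℝ,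
      ContDiff ℝ (⊤ : ℕ∞) (Function.uncurry φ) ∧
      HasCompactSupport (Function.uncurry φ) ∧
      (∀ x t, 0 ≤ φ x t) ∧
      (∀ x, φ x (R ^ θ) = 0) ∧
      (∀ x t, x ∉ Metric.ball z (2 * R) → φ x t = 0) ∧
      (∀ x t, 0 < t → t < R ^ θ → φ x t ≤ Real.exp κ) ∧
      (∀ x t, x ∈ Metric.ball z R → 0 ≤ t → t < (R / 2) ^ θ → 1 ≤ φ x t) ∧
      (∀ x t, x ∈ Metric.ball z R → 0 < t → t < (R / 2) ^ θ →
        -(deriv (φ x) t) + fracLap N θ (fun y => φ y t) x ≤ 0) ∧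
      (∀ x t, 0 < t → t < R ^ θ →
        -(deriv (φ x) t) + fracLap N θ (fun y => φ y t) x ≤ K * R ^ (-θ) * φ x t ^ (1 / p)) := by
  have hθ0 : 0 < θ := hθ.1
  obtain ⟨m, hm⟩ := exists_nat_ge (1 / (p - 1))
  have hmp : ((m:ℝ) + 1) / p ≤ m := by
    rw [div_le_iff₀ (by linarith)] at hm ⊢
    linarith
  let χ : ContDiffBump (0:ℝ) := ⟨(1/2)^θ, 1, by positivity,
    Real.rpow_lt_one (by norm_num) (by norm_num) hθ0⟩
  let ζ : ContDiffBump (0 : EN N) := ⟨1, 2, by norm_num, by norm_num⟩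
  have hχs : ContDiff ℝ (⊤ : ℕ∞) χ := χ.contDiff
  have hζs : ContDiff ℝ (⊤ : ℕ∞) ζ := ζ.contDiff
  obtain ⟨B1, hB1⟩ := (χ.hasCompactSupport.deriv).exists_bound_of_continuous
    (hχs.continuous_deriv (by simp))
  have hB10 : 0 ≤ B1 := (norm_nonneg _).trans (hB1 0)
  obtain ⟨B2, hB20, hB2⟩ := aux_fl_bound hN hθ hζs ζ.hasCompactSupport
  set κ : ℝ := (m + 1) * B2 with hκ
  have hκ0 : 0 ≤ κ := by positivity
  refine ⟨Real.exp κ * ((m + 1) * (B1 + B2)) + 1, κ, by positivity, hκ0, fun R hR z => ?_⟩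
  set ρ : ℝ := R ^ (-θ) with hρ
  have hρ0 : 0 < ρ := by positivity
  have hρR : ρ * R ^ θ = 1 := by rw [hρ, ← Real.rpow_add hR]; simp
  have hρR2 : ρ * (R / 2) ^ θ = (1/2) ^ θ := by
    rw [div_eq_mul_one_div, Real.mul_rpow hR.le (by norm_num), ← mul_assoc, hρR, one_mul]
  let φ : EN N → ℝ → ℝ := fun x t =>
    (Real.exp (κ * (ρ * t)) * χ (ρ * t) ^ (m + 1)) * ζ (R⁻¹ • (x - z)) ^ (m + 1)
  have hζz : ∀ x, x ∉ Metric.ball z (2 * R) → ζ (R⁻¹ • (x - z)) = 0 := by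
    intro x hx
    apply ζ.zero_of_le_dist
    rw [dist_zero_right, norm_smul, Real.norm_of_nonneg (by positivity), le_inv_mul_iff₀ hR,
      ← dist_eq_norm]
    rw [Metric.mem_ball, not_lt] at hx
    change R * 2 ≤ _
    linarith
  have hζ1 : ∀ x, x ∈ Metric.ball z R → ζ (R⁻¹ • (x - z)) = 1 := by
    intro x hx
    apply ζ.one_of_mem_closedBall
    rw [mem_closedBall_zero_iff, norm_smul, Real.norm_of_nonneg (by positivity), inv_mul_le_iff₀ hR,
      ← dist_eq_norm]
    rw [Metric.mem_ball] at hx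
    change _ ≤ R * 1
    linarith
  have hχz : ∀ t, R ^ θ ≤ |t| → χ (ρ * t) = 0 := by
    intro t ht
    apply χ.zero_of_le_dist
    rw [dist_zero_right, Real.norm_eq_abs, abs_mul, abs_of_pos hρ0]
    change 1 ≤ _
    rw [← hρR]
    gcongr
  have hχ1 : ∀ t, |t| ≤ (R/2) ^ θ → χ (ρ * t) = 1 := by
    intro t ht
    apply χ.one_of_mem_closedBall
    rw [mem_closedBall_zero_iff, Real.norm_eq_abs, abs_mul, abs_of_pos hρ0]
    change _ ≤ (1/2:ℝ) ^ θ
    rw [← hρR2]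
    gcongr
  have hderiv : ∀ x t, deriv (φ x) t =
      Real.exp (κ * (ρ * t)) * ρ * (κ * χ (ρ * t) ^ (m+1) + (m+1) * χ (ρ * t) ^ m * deriv χ (ρ * t))
        * ζ (R⁻¹ • (x - z)) ^ (m + 1) := by
    intro x t
    have h1 : HasDerivAt (fun t : ℝ => ρ * t) ρ t := by simpa using (hasDerivAt_id t).const_mul ρ
    have h2 : HasDerivAt (fun t : ℝ => χ (ρ * t)) (deriv χ (ρ * t) * ρ) t :=
      ((hχs.differentiable (by simp)).differentiableAt.hasDerivAt).comp t h1
    have h3 := (((h1.const_mul κ).exp.mul (h2.pow (m+1))).mul_const (ζ (R⁻¹ • (x - z)) ^ (m + 1))).deriv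
    refine Eq.trans h3 ?_
    push_cast
    simp only [Pi.pow_apply]
    ring
  have hfl : ∀ x t, fracLap N θ (fun y => φ y t) x ≤
      Real.exp (κ * (ρ * t)) * ρ * (χ (ρ * t) ^ (m+1) * ((m+1) * B2) * ζ (R⁻¹ • (x - z)) ^ m) := by
    intro x t
    have e1 : fracLap N θ (fun y => φ y t) x = (Real.exp (κ * (ρ * t)) * χ (ρ * t) ^ (m + 1)) *
        (ρ * fracLap N θ (fun y => ζ y ^ (m+1)) (R⁻¹ • (x - z))) := by
      rw [hρ, ← aux_fl_scale hR z (fun y => ζ y ^ (m+1)) x, ← aux_fl_const_mul]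
    have e2 := aux_fl_pow hN hθ hζs ζ.hasCompactSupport (fun x => ζ.nonneg) m (R⁻¹ • (x - z))
    have e3 : fracLap N θ (fun y => ζ y ^ (m+1)) (R⁻¹ • (x - z)) ≤ (m+1) * ζ (R⁻¹ • (x - z)) ^ m * B2 := by
      refine e2.trans (mul_le_mul_of_nonneg_left (hB2 _) ?_)
      have := ζ.nonneg' (R⁻¹ • (x - z))
      positivity
    have hc0 := χ.nonneg' (ρ * t)
    rw [e1]
    calc _ ≤ (Real.exp (κ * (ρ * t)) * χ (ρ * t) ^ (m + 1)) *
        (ρ * ((m+1) * ζ (R⁻¹ • (x - z)) ^ m * B2)) := by gcongr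
      _ = _ := by ring
  refine ⟨φ, ?_, ?_, ?_, ?_, ?_, ?_, ?_, ?_, ?_⟩
  · have h1 : ContDiff ℝ (⊤ : ℕ∞) (fun q : EN N × ℝ => χ (ρ * q.2)) := hχs.comp (by fun_prop)
    have h2 : ContDiff ℝ (⊤ : ℕ∞) (fun q : EN N × ℝ => ζ (R⁻¹ • (q.1 - z))) := hζs.comp (by fun_prop)
    have h3 : ContDiff ℝ (⊤ : ℕ∞) (fun q : EN N × ℝ => Real.exp (κ * (ρ * q.2))) := by fun_prop
    exact (h3.mul (h1.pow (m+1))).mul (h2.pow (m+1))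
  · refine HasCompactSupport.intro
      ((isCompact_closedBall z (2*R)).prod (isCompact_closedBall (0:ℝ) (R^θ))) ?_
    rintro ⟨x, t⟩ hq
    rw [Set.mem_prod, not_and_or] at hq
    rcases hq with h | h
    · simp [Function.uncurry, φ, hζz x (fun h' => h (Metric.ball_subset_closedBall h'))]
    · have : R ^ θ ≤ |t| := by
        simp only [mem_closedBall_zero_iff, Real.norm_eq_abs, not_le] at h
        exact h.le
      simp [Function.uncurry, φ, hχz t this]
  · intro x t
    have := χ.nonneg' (ρ * t); have := ζ.nonneg' (R⁻¹ • (x - z))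
    positivity
  · intro x
    simp [φ, hχz (R ^ θ) (le_abs_self _)]
  · intro x t hx
    simp [φ, hζz x hx]
  · intro x t h0 ht
    have a1 : χ (ρ * t) ^ (m+1) ≤ 1 := pow_le_one₀ χ.nonneg χ.le_one
    have a2 : ζ (R⁻¹ • (x - z)) ^ (m+1) ≤ 1 := pow_le_one₀ ζ.nonneg ζ.le_one
    have a3 : Real.exp (κ * (ρ * t)) ≤ Real.exp κ := by
      apply Real.exp_le_exp.2
      have : ρ * t ≤ 1 := by rw [← hρR]; gcongr
      nlinarith
    have b2 : 0 ≤ ζ (R⁻¹ • (x - z)) ^ (m+1) := pow_nonneg ζ.nonneg _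
    have b1 : 0 ≤ χ (ρ * t) ^ (m+1) := pow_nonneg χ.nonneg _
    calc φ x t ≤ (Real.exp κ * 1) * 1 := by
          simp only [φ]; gcongr
      _ = _ := by ring
  · intro x t hx h0 ht
    simp only [φ, hζ1 x hx, hχ1 t (by rw [abs_of_nonneg h0]; exact ht.le), one_pow, mul_one]
    apply Real.one_le_exp; positivity
  · intro x t hx h0 ht
    have hd : deriv χ (ρ * t) = 0 := by
      have : (χ : ℝ → ℝ) =ᶠ[nhds (ρ * t)] 1 := by
        apply χ.eventuallyEq_one_of_mem_ball
        rw [mem_ball_zero_iff, Real.norm_eq_abs, abs_mul, abs_of_pos hρ0, abs_of_pos h0]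
        change _ < (1/2:ℝ) ^ θ
        rw [← hρR2]
        gcongr
      rw [this.deriv_eq]; simp
    have h1 := hfl x t
    rw [hderiv, hd, hζ1 x hx, hχ1 t (by rw [abs_of_nonneg h0.le]; exact ht.le)]
    rw [hζ1 x hx, hχ1 t (by rw [abs_of_nonneg h0.le]; exact ht.le)] at h1
    simp only [one_pow, mul_one, mul_zero, add_zero, one_mul] at h1 ⊢
    rw [← hκ] at h1
    linarith
  · intro x t h0 ht
    have h1 := hfl x t
    rw [hderiv]
    set e := Real.exp (κ * (ρ * t)) with he
    set a := χ (ρ * t) with ha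
    set b := ζ (R⁻¹ • (x - z)) with hb
    have ha0 : 0 ≤ a := χ.nonneg
    have hb0 : 0 ≤ b := ζ.nonneg
    have ha1 : a ≤ 1 := χ.le_one
    have hb1 : b ≤ 1 := ζ.le_one
    have he1 : 1 ≤ e := by apply Real.one_le_exp; positivity
    have he2 : e ≤ Real.exp κ := by
      apply Real.exp_le_exp.2
      have : ρ * t ≤ 1 := by rw [← hρR]; gcongr
      nlinarith
    have hd := abs_le.1 (hB1 (ρ * t))
    have step1 : (a * b) ^ m ≤ φ x t ^ (1/p) := by
      have hab0 : 0 ≤ a * b := by positivity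
      have hab1 : a * b ≤ 1 := mul_le_one₀ ha1 hb0 hb1
      calc (a * b) ^ m = (a * b) ^ (m:ℝ) := (Real.rpow_natCast _ _).symm
        _ ≤ (a * b) ^ (((m:ℝ) + 1) / p) :=
          Real.rpow_le_rpow_of_exponent_ge' hab0 hab1 (by positivity) hmp
        _ = ((a * b) ^ (m+1)) ^ (1/p) := by
          rw [← Real.rpow_natCast, ← Real.rpow_mul hab0]; congr 1; push_cast; ring
        _ ≤ _ := by
          refine Real.rpow_le_rpow (by positivity) ?_ (by positivity)
          change _ ≤ (e * a ^ (m+1)) * b ^ (m+1)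
          rw [mul_pow]
          have : 0 ≤ a ^ (m+1) * b ^ (m+1) := by positivity
          nlinarith
    have step2 : -(e * ρ * (κ * a ^ (m+1) + (m+1) * a ^ m * deriv χ (ρ * t)) * b ^ (m+1)) +
        fracLap N θ (fun y => φ y t) x ≤ e * ρ * (((m+1) * (B1 + B2)) * (a * b) ^ m) := by
      have c1 : 0 ≤ κ * a ^ (m+1) * b ^ (m+1) := by positivity
      have c2 : -((m+1) * a ^ m * deriv χ (ρ * t) * b ^ (m+1)) ≤ (m+1) * (a * b) ^ m * B1 := by
        have q1 : b ^ (m+1) ≤ b ^ m := pow_le_pow_of_le_one hb0 hb1 (by omega)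
        calc -((m+1) * a ^ m * deriv χ (ρ * t) * b ^ (m+1))
            = (m+1) * a ^ m * b ^ (m+1) * (- deriv χ (ρ * t)) := by ring
          _ ≤ (m+1) * a ^ m * b ^ (m+1) * B1 := by gcongr; linarith [hd.1]
          _ ≤ (m+1) * a ^ m * b ^ m * B1 := by gcongr
          _ = _ := by rw [mul_pow]; ring
      have c3 : a ^ (m+1) * ((m+1) * B2) * b ^ m ≤ (m+1) * (a * b) ^ m * B2 := by
        have q1 : a ^ (m+1) ≤ a ^ m := pow_le_pow_of_le_one ha0 ha1 (by omega)
        calc a ^ (m+1) * ((m+1) * B2) * b ^ m ≤ a ^ m * ((m+1) * B2) * b ^ m := by gcongr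
          _ = _ := by rw [mul_pow]; ring
      have heρ : 0 ≤ e * ρ := by positivity
      have := mul_le_mul_of_nonneg_left (add_le_add c2 c3) heρ
      have := mul_nonneg heρ c1
      nlinarith
    refine step2.trans ?_
    have hq : 0 ≤ (a * b) ^ m := by positivity
    calc e * ρ * (((m+1) * (B1 + B2)) * (a * b) ^ m)
        = e * ((m+1) * (B1 + B2)) * ρ * (a * b) ^ m := by ring
      _ ≤ (Real.exp κ * ((m + 1) * (B1 + B2)) + 1) * ρ * φ x t ^ (1/p) := by
        gcongr
        have : e * ((m+1) * (B1 + B2)) ≤ Real.exp κ * ((m + 1) * (B1 + B2)) := by gcongr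
        linarith

theorem aux_iterint {N : ℕ} {τ : ℝ} {B : Set (EN N)} (F : EN N × ℝ → ℝ)
    (hF : IntegrableOn F (B ×ˢ Set.Ioo (0:ℝ) τ)) (h0 : ∀ q : EN N × ℝ, q.1 ∉ B → F q = 0) :
    Integrable F ((volume : Measure (EN N)).prod ((volume : Measure ℝ).restrict (Set.Ioo 0 τ))) ∧
    ∫ t in Set.Ioo (0:ℝ) τ, ∫ x, F (x, t) = ∫ q in B ×ˢ Set.Ioo (0:ℝ) τ, F q := by
  have hm : (volume : Measure (EN N)).prod ((volume : Measure ℝ).restrict (Set.Ioo 0 τ))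
      = (volume : Measure (EN N × ℝ)).restrict (Set.univ ×ˢ Set.Ioo (0:ℝ) τ) := by
    have := Measure.prod_restrict (μ := (volume : Measure (EN N))) (ν := (volume : Measure ℝ))
      Set.univ (Set.Ioo (0:ℝ) τ)
    rw [Measure.restrict_univ] at this
    exact this
  have hmu : MeasurableSet ((Set.univ : Set (EN N)) ×ˢ Set.Ioo (0:ℝ) τ) :=
    MeasurableSet.univ.prod measurableSet_Ioo
  have hz : ∀ q ∈ ((Set.univ : Set (EN N)) ×ˢ Set.Ioo (0:ℝ) τ) \ (B ×ˢ Set.Ioo (0:ℝ) τ), F q = 0 := by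
    intro q hq
    refine h0 q fun hB => hq.2 ⟨hB, hq.1.2⟩
  have hi : Integrable F ((volume : Measure (EN N)).prod ((volume : Measure ℝ).restrict (Set.Ioo 0 τ))) := by
    rw [hm]
    exact hF.of_forall_sdiff_eq_zero hmu hz
  refine ⟨hi, ?_⟩
  rw [← integral_prod_symm F hi, hm]
  exact setIntegral_eq_of_subset_of_forall_sdiff_eq_zero hmu
    (Set.prod_mono (Set.subset_univ _) le_rfl) hz

theorem aux_integral_le {α : Type*} [MeasurableSpace α] {ν : Measure α} {f g : α → ℝ}
    (hg : Integrable g ν) (g0 : 0 ≤ᵐ[ν] g) (h : f ≤ᵐ[ν] g) : ∫ a, f a ∂ν ≤ ∫ a, g a ∂ν := by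
  by_cases hf : Integrable f ν
  · exact integral_mono_ae hf hg h
  · rw [integral_undef hf]; exact integral_nonneg_of_ae g0

theorem aux_step {N : ℕ} (hN : 1 ≤ N) {θ : ℝ} (hθ : θ ∈ Set.Ioo (0:ℝ) 2) {p : ℝ}
    (hpF : p = 1 + θ / N) :
    ∃ C c : ℝ, 0 < C ∧ 0 < c ∧ c ≤ 1 ∧ ∀ T : ℝ, ∀ μ : Measure (EN N),
      IsFiniteMeasureOnCompacts μ → ∀ u, IsVeryWeakSupersolutionFrac N θ p T μ u →
      ∀ z : EN N, ∀ R : ℝ, 0 < R → R ^ θ < T → ∃ a : ℝ, 0 ≤ a ∧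
        (∫ q in Metric.ball z R ×ˢ Set.Ioo (0:ℝ) ((R / 2) ^ θ), u q.1 q.2 ^ p) + c * a ≤
          (∫ q in Metric.ball z (2 * R) ×ˢ Set.Ioo (0:ℝ) (R ^ θ), u q.1 q.2 ^ p) ∧
        μ.real (Metric.ball z R) +
          (∫ q in Metric.ball z R ×ˢ Set.Ioo (0:ℝ) ((R / 2) ^ θ), u q.1 q.2 ^ p) + a ≤
          C * a ^ (1 / p) := by
  have : Nonempty (Fin N) := ⟨⟨0, hN⟩⟩
  have hθ0 : 0 < θ := hθ.1
  have hNpos : (0:ℝ) < N := by exact_mod_cast hN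
  have hp : 1 < p := by rw [hpF]; have : 0 < θ / N := by positivity
                        linarith
  have hp0 : 0 < p := by linarith
  obtain ⟨K, κ, hK, hκ, htest⟩ := aux_test hN hθ hp
  set ω : ℝ := volume.real (Metric.ball (0 : EN N) 1) with hω
  have hω0 : 0 < ω := by
    rw [hω, Measure.real, ENNReal.toReal_pos_iff]
    exact ⟨Metric.measure_ball_pos _ _ one_pos, measure_ball_lt_top⟩
  let q : ℝ := (N + θ) / θ
  have hpq : p.HolderConjugate q := by
    rw [Real.holderConjugate_iff]
    refine ⟨hp, ?_⟩
    rw [hpF]; simp only [q]; field_simp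
  refine ⟨K * (ω * 2 ^ N) ^ (1/q), Real.exp (-κ), by positivity, by positivity, by simpa using hκ, ?_⟩
  intro T μ hμ u hu z R hR hRT
  obtain ⟨humeas, hupos, huint, hweak⟩ := hu
  obtain ⟨φ, hφs, hφc, hφ0, hφτ, hφz, hφle, hφ1, hD0, hDle⟩ := htest R hR z
  have hτ0 : 0 < R ^ θ := by positivity
  have hτi : (R/2) ^ θ ≤ R ^ θ := Real.rpow_le_rpow (by positivity) (by linarith) hθ0.le
  set Qo : Set (EN N × ℝ) := Metric.ball z (2 * R) ×ˢ Set.Ioo (0:ℝ) (R ^ θ) with hQo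
  set Qi : Set (EN N × ℝ) := Metric.ball z R ×ˢ Set.Ioo (0:ℝ) ((R / 2) ^ θ) with hQi
  have hio : Qi ⊆ Qo := Set.prod_mono (Metric.ball_subset_ball (by linarith))
    (Set.Ioo_subset_Ioo le_rfl hτi)
  have mQo : MeasurableSet Qo := Metric.isOpen_ball.measurableSet.prod measurableSet_Ioo
  have mQi : MeasurableSet Qi := Metric.isOpen_ball.measurableSet.prod measurableSet_Ioo
  set A := Qo \ Qi with hA
  have mA : MeasurableSet A := mQo.diff mQi
  have hAo : A ⊆ Qo := Set.sdiff_subset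
  let v : EN N × ℝ → ℝ := fun q => u q.1 q.2
  let w : EN N × ℝ → ℝ := fun q => u q.1 q.2 ^ p
  let Φ : EN N × ℝ → ℝ := fun q => φ q.1 q.2
  have mv : Measurable v := humeas
  have mw : Measurable w := mv.pow_const p
  have cΦ : Continuous Φ := hφs.continuous
  have mΦ : Measurable Φ := cΦ.measurable
  have hΦ0 : ∀ q, 0 ≤ Φ q := fun q => hφ0 _ _
  have hΦe : ∀ q ∈ Qo, Φ q ≤ Real.exp κ := fun q hq => hφle _ _ hq.2.1 hq.2.2
  have hv0 : ∀ q ∈ Qo, 0 ≤ v q := fun q hq => hupos _ _ ⟨hq.2.1, hq.2.2.trans hRT⟩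
  have hw0 : ∀ q ∈ Qo, 0 ≤ w q := fun q hq => Real.rpow_nonneg (hv0 q hq) _
  have hK' := huint (Metric.closedBall z (2*R)) (isCompact_closedBall _ _) (R ^ θ) ⟨hτ0, hRT⟩
  have hsub : Qo ⊆ Metric.closedBall z (2*R) ×ˢ Set.Ioo (0:ℝ) (R ^ θ) :=
    Set.prod_mono Metric.ball_subset_closedBall le_rfl
  have iv : IntegrableOn v Qo := hK'.1.mono_set hsub
  have iw : IntegrableOn w Qo := hK'.2.mono_set hsub
  have iwΦ : IntegrableOn (fun q => w q * Φ q) Qo := by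
    refine (iw.const_mul (Real.exp κ)).mono' (mw.mul mΦ).aestronglyMeasurable ?_
    refine (ae_restrict_iff' mQo).2 (Filter.Eventually.of_forall fun q hq => ?_)
    rw [Real.norm_of_nonneg (mul_nonneg (hw0 q hq) (hΦ0 q)), mul_comm]
    exact mul_le_mul_of_nonneg_right (hΦe q hq) (hw0 q hq)
  have ivΦ : IntegrableOn (fun q => v q * Φ q ^ (1/p)) Qo := by
    refine (iv.const_mul (Real.exp κ ^ (1/p))).mono' (mv.mul (mΦ.pow_const _)).aestronglyMeasurable ?_
    refine (ae_restrict_iff' mQo).2 (Filter.Eventually.of_forall fun q hq => ?_)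
    rw [Real.norm_of_nonneg (mul_nonneg (hv0 q hq) (Real.rpow_nonneg (hΦ0 q) _)), mul_comm]
    exact mul_le_mul_of_nonneg_right (Real.rpow_le_rpow (hΦ0 q) (hΦe q hq) (by positivity)) (hv0 q hq)
  have hwA : ∫ q in A, w q = (∫ q in Qo, w q) - ∫ q in Qi, w q := setIntegral_sdiff mQi iw hio
  have hwΦA : ∫ q in A, w q * Φ q = (∫ q in Qo, w q * Φ q) - ∫ q in Qi, w q * Φ q :=
    setIntegral_sdiff mQi iwΦ hio
  set a := ∫ q in A, w q * Φ q with ha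
  have ha0 : 0 ≤ a := setIntegral_nonneg mA fun q hq => mul_nonneg (hw0 q (hAo hq)) (hΦ0 q)
  refine ⟨a, ha0, ?_, ?_⟩
  · have : a ≤ Real.exp κ * ∫ q in A, w q := by
      rw [← integral_const_mul]
      refine setIntegral_mono_on (iwΦ.mono_set hAo) ((iw.mono_set hAo).const_mul _) mA fun q hq => ?_
      rw [mul_comm]
      exact mul_le_mul_of_nonneg_right (hΦe q (hAo hq)) (hw0 q (hAo hq))
    have h2 : Real.exp (-κ) * a ≤ ∫ q in A, w q := by
      rw [Real.exp_neg, inv_mul_le_iff₀ (Real.exp_pos _)]; exact this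
    rw [hwA] at h2
    change (∫ q in Qi, w q) + _ ≤ ∫ q in Qo, w q
    linarith
  · have hW := hweak (R ^ θ) ⟨hτ0, hRT⟩ φ hφs hφc hφ0 hφτ
    -- data term
    have t1 : μ.real (Metric.ball z R) ≤ ∫ x, φ x 0 ∂μ := by
      have hc0 : Continuous (fun x => φ x 0) := cΦ.comp (by fun_prop : Continuous fun x : EN N => (x, (0:ℝ)))
      have hcs : HasCompactSupport (fun x => φ x 0) :=
        HasCompactSupport.intro (isCompact_closedBall z (2*R)) fun x hx =>
          hφz x 0 fun h => hx (Metric.ball_subset_closedBall h)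
      have hi : Integrable (fun x => φ x 0) μ := hc0.integrable_of_hasCompactSupport hcs
      calc μ.real (Metric.ball z R) = ∫ x in Metric.ball z R, (1:ℝ) ∂μ := by simp
        _ ≤ ∫ x in Metric.ball z R, φ x 0 ∂μ := by
          refine setIntegral_mono_on ?_ hi.integrableOn Metric.isOpen_ball.measurableSet
            fun x hx => hφ1 x 0 hx le_rfl (by positivity)
          exact integrableOn_const measure_ball_lt_top.ne
        _ ≤ _ := setIntegral_le_integral hi (Filter.Eventually.of_forall fun x => hφ0 x 0)
    -- nonlinear term
    have t2 : (∫ q in Qi, w q) + a ≤ ∫ t in Set.Ioo (0:ℝ) (R ^ θ), ∫ x, u x t ^ p * φ x t := by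
      have h1 := (aux_iterint (fun q => w q * Φ q) iwΦ (fun q hq => by simp [Φ, hφz _ _ hq])).2
      have h2 : (∫ q in Qi, w q) ≤ ∫ q in Qi, w q * Φ q := by
        refine setIntegral_mono_on (iw.mono_set hio) (iwΦ.mono_set hio) mQi fun q hq => ?_
        exact le_mul_of_one_le_right (hw0 q (hio hq)) (hφ1 _ _ hq.1 hq.2.1.le hq.2.2)
      have h3 : ∫ t in Set.Ioo (0:ℝ) (R ^ θ), ∫ x, u x t ^ p * φ x t = ∫ q in Qo, w q * Φ q := h1
      rw [h3]; linarith
    -- linear term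
    let F : EN N × ℝ → ℝ := A.indicator fun q => K * R ^ (-θ) * (v q * Φ q ^ (1/p))
    have iF : IntegrableOn F Qo := (ivΦ.const_mul _).indicator mA
    have hFz : ∀ q : EN N × ℝ, q.1 ∉ Metric.ball z (2*R) → F q = 0 := fun q hq =>
      Set.indicator_of_notMem (fun h => hq (hAo h).1) _
    obtain ⟨iF', eF⟩ := aux_iterint F iF hFz
    have F0 : ∀ q, 0 ≤ F q := fun q => Set.indicator_nonneg (fun q hq => by
      have := hv0 q (hAo hq)
      have := Real.rpow_nonneg (hΦ0 q) (1/p)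
      positivity) q
    have hFle : ∀ x t, t ∈ Set.Ioo (0:ℝ) (R ^ θ) →
        u x t * (-(deriv (φ x) t) + fracLap N θ (fun y => φ y t) x) ≤ F (x, t) := by
      intro x t ht
      have hu0 := hupos x t ⟨ht.1, ht.2.trans hRT⟩
      have hd := hDle x t ht.1 ht.2
      by_cases hq : (x, t) ∈ A
      · simp only [F, Set.indicator_of_mem hq, v, Φ]
        calc _ ≤ u x t * (K * R ^ (-θ) * φ x t ^ (1 / p)) := mul_le_mul_of_nonneg_left hd hu0
          _ = _ := by ring
      · simp only [F, Set.indicator_of_notMem hq]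
        refine mul_nonpos_of_nonneg_of_nonpos hu0 ?_
        by_cases hx : x ∈ Metric.ball z (2*R)
        · have : (x, t) ∈ Qi := by
            by_contra h; exact hq ⟨⟨hx, ht⟩, h⟩
          exact hD0 x t this.1 this.2.1 this.2.2
        · rw [hφz x t hx, Real.zero_rpow (by positivity), mul_zero] at hd
          exact hd
    have t3 : (∫ t in Set.Ioo (0:ℝ) (R ^ θ), ∫ x,
        u x t * (-(deriv (φ x) t) + fracLap N θ (fun y => φ y t) x)) ≤ ∫ q in Qo, F q := by
      rw [← eF]
      refine aux_integral_le iF'.integral_prod_right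
        (Filter.Eventually.of_forall fun t => integral_nonneg fun x => F0 _) ?_
      filter_upwards [iF'.prod_left_ae, ae_restrict_mem measurableSet_Ioo] with t ht1 ht2
      exact aux_integral_le ht1 (Filter.Eventually.of_forall fun x => F0 _)
        (Filter.Eventually.of_forall fun x => hFle x t ht2)
    -- Hoelder
    have hpowA : ∀ q ∈ A, (v q * Φ q ^ (1/p)) ^ p = w q * Φ q := by
      intro q hq
      rw [Real.mul_rpow (hv0 q (hAo hq)) (Real.rpow_nonneg (hΦ0 q) _), ← Real.rpow_mul (hΦ0 q),
        one_div_mul_cancel hp0.ne', Real.rpow_one]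
    have hQfin : volume Qo ≠ ⊤ := by
      rw [hQo, Measure.volume_eq_prod, Measure.prod_prod]
      exact ENNReal.mul_ne_top measure_ball_lt_top.ne (by simp)
    have hAfin : volume A ≠ ⊤ := ((measure_mono hAo).trans_lt (lt_top_iff_ne_top.2 hQfin)).ne
    have : IsFiniteMeasure (volume.restrict A) := ⟨by
      rw [Measure.restrict_apply_univ]; exact lt_top_iff_ne_top.2 hAfin⟩
    have hvol : volume.real A ≤ (ω * 2 ^ N) * R ^ ((N:ℝ) + θ) := by
      refine (measureReal_mono hAo hQfin).trans (le_of_eq ?_)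
      rw [hQo, Measure.real, Measure.volume_eq_prod, Measure.prod_prod,
        Measure.addHaar_ball volume z (by positivity), ENNReal.toReal_mul, ENNReal.toReal_mul,
        ENNReal.toReal_ofReal (by positivity), Real.volume_Ioo, ENNReal.toReal_ofReal (by simpa using hτ0.le),
        Real.rpow_add hR, Real.rpow_natCast]
      simp only [finrank_euclideanSpace, Fintype.card_fin]
      rw [hω, Measure.real]
      ring
    have hH : ∫ q in A, v q * Φ q ^ (1/p) ≤ a ^ (1/p) * (volume.real A) ^ (1/q) := by
      have hm1 : MemLp (fun q => v q * Φ q ^ (1/p)) (ENNReal.ofReal p) (volume.restrict A) := by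
        have hms : AEStronglyMeasurable (fun q => v q * Φ q ^ (1/p)) (volume.restrict A) :=
          (mv.mul (mΦ.pow_const _)).aestronglyMeasurable
        rw [← integrable_norm_rpow_iff hms (by simpa using hp0) ENNReal.ofReal_ne_top]
        rw [ENNReal.toReal_ofReal hp0.le]
        refine IntegrableOn.congr_fun (iwΦ.mono_set hAo) ?_ mA
        intro q hq
        simp only
        rw [Real.norm_of_nonneg (mul_nonneg (hv0 q (hAo hq)) (Real.rpow_nonneg (hΦ0 q) _)), hpowA q hq]
      have := integral_mul_le_Lp_mul_Lq_of_nonneg (μ := volume.restrict A) hpq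
        (f := fun q => v q * Φ q ^ (1/p)) (g := fun _ => 1)
        ((ae_restrict_iff' mA).2 (Filter.Eventually.of_forall fun q hq =>
          mul_nonneg (hv0 q (hAo hq)) (Real.rpow_nonneg (hΦ0 q) _)))
        (Filter.Eventually.of_forall fun _ => zero_le_one) hm1 (memLp_const _)
      rw [setIntegral_congr_fun mA hpowA] at this
      simpa using this
    have hFA : ∫ q in Qo, F q = K * R ^ (-θ) * ∫ q in A, v q * Φ q ^ (1/p) := by
      rw [setIntegral_indicator mA, Set.inter_eq_right.2 hAo, integral_const_mul]
    have hq0 : 0 < 1 / q := by simp only [q]; positivity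
    have hfin : ∫ q in Qo, F q ≤ K * (ω * 2 ^ N) ^ (1/q) * a ^ (1/p) := by
      rw [hFA]
      have e1 : (volume.real A) ^ (1/q) ≤ (ω * 2 ^ N) ^ (1/q) * R ^ θ := by
        calc _ ≤ ((ω * 2 ^ N) * R ^ ((N:ℝ) + θ)) ^ (1/q) :=
              Real.rpow_le_rpow measureReal_nonneg hvol hq0.le
          _ = _ := by
            rw [Real.mul_rpow (by positivity) (by positivity), ← Real.rpow_mul hR.le]
            congr 2
            simp only [q]; field_simp
      have e2 : R ^ (-θ) * R ^ θ = 1 := by rw [← Real.rpow_add hR]; simp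
      calc K * R ^ (-θ) * ∫ q in A, v q * Φ q ^ (1/p)
          ≤ K * R ^ (-θ) * (a ^ (1/p) * ((ω * 2 ^ N) ^ (1/q) * R ^ θ)) := by
            refine mul_le_mul_of_nonneg_left (hH.trans ?_) (by positivity)
            exact mul_le_mul_of_nonneg_left e1 (by positivity)
        _ = (R ^ (-θ) * R ^ θ) * (K * (ω * 2 ^ N) ^ (1/q) * a ^ (1/p)) := by ring
        _ = _ := by rw [e2, one_mul]
    change μ.real (Metric.ball z R) + (∫ q in Qi, w q) + a ≤ _
    linarith

/-- Necessary condition on the initial data for the existence of a very weak supersolution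
of the fractional semilinear heat equation, in the critical (Fujita) case `p = 1 + θ/N`. -/
theorem stmt_1 (N : ℕ) (hN : 1 ≤ N) (θ : ℝ) (hθ : θ ∈ Set.Ioo (0:ℝ) 2)
    (p : ℝ) (hpF : p = 1 + θ / N) :
    ∃ γ : ℝ, 0 < γ ∧ ∀ T : ℝ, 0 < T →
      ∀ μ : Measure (EuclideanSpace ℝ (Fin N)), IsFiniteMeasureOnCompacts μ →
      (∃ u, IsVeryWeakSupersolutionFrac N θ p T μ u) →
      ∀ z : EuclideanSpace ℝ (Fin N), ∀ σ : ℝ, 0 < σ → σ < T ^ (1/θ) →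
        μ (Metric.ball z σ) ≤
          ENNReal.ofReal (γ * (Real.log (Real.exp 1 + T ^ (1/θ) / σ)) ^ (-(N:ℝ)/θ)) := by
  obtain ⟨C, c, hC, hc, hc1, hstep⟩ := aux_step hN hθ hpF
  have hθ0 : 0 < θ := hθ.1
  have hNpos : (0:ℝ) < N := by exact_mod_cast hN
  have hp1 : p - 1 = θ / N := by rw [hpF]; ring
  have hp : 1 < p := by have : 0 < θ / N := by positivity
                        linarith
  set d : ℝ := (p - 1) * (c * C ^ (-p)) with hd
  have hd0 : 0 < d := by have : 0 < p - 1 := by linarith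
                         positivity
  have hl8 : 0 < Real.log 8 := Real.log_pos (by norm_num)
  refine ⟨(d / Real.log 8) ^ (-(N:ℝ)/θ), by positivity, ?_⟩
  intro T hT μ hμ ⟨u, hu⟩ z σ hσ hσT
  set S : ℝ := T ^ (1/θ) with hS
  have hS0 : 0 < S := by positivity
  have hST : S ^ θ = T := by rw [hS, ← Real.rpow_mul hT.le, one_div_mul_cancel hθ0.ne', Real.rpow_one]
  have hfin : μ (Metric.ball z σ) ≠ ⊤ := measure_ball_lt_top.ne
  rw [ENNReal.le_ofReal_iff_toReal_le hfin (by
    have : 0 ≤ Real.log (Real.exp 1 + S / σ) := Real.log_nonneg (by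
      have := Real.one_le_exp (zero_le_one (α := ℝ)); have : 0 < S / σ := by positivity
      linarith)
    positivity)]
  have hx1 : 1 < S / σ := (one_lt_div hσ).2 hσT
  -- number of steps
  obtain ⟨k, hk1, hk2⟩ := exists_nat_pow_near hx1.le (by norm_num : (1:ℝ) < 2)
  -- possibly 2^k = S/σ : handle by choosing n
  obtain ⟨n, hn1, hnlt, hnle⟩ : ∃ n : ℕ, 1 ≤ n ∧ (∀ j < n, (2:ℝ) ^ j * σ < S) ∧ S / σ ≤ 2 ^ n := by
    rcases hk1.lt_or_eq with h | h
    · refine ⟨k + 1, by omega, fun j hj => ?_, hk2.le⟩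
      rw [← lt_div_iff₀ hσ]
      exact (pow_le_pow_right₀ (by norm_num) (by omega)).trans_lt h
    · refine ⟨k, ?_, fun j hj => ?_, h.ge⟩
      · rcases Nat.eq_zero_or_pos k with h0 | h0
        · rw [h0, pow_zero] at h; linarith
        · exact h0
      · rw [← lt_div_iff₀ hσ, ← h]
        exact pow_lt_pow_right₀ (by norm_num) hj
  have hn0 : (0:ℝ) < n := by exact_mod_cast hn1
  have hlog : Real.log (Real.exp 1 + S / σ) ≤ n * Real.log 8 := by
    rw [← Real.log_pow]
    apply Real.log_le_log (by positivity)
    have h2 : (2:ℝ) ≤ 2 ^ n := by simpa using pow_le_pow_right₀ (by norm_num : (1:ℝ) ≤ 2) hn1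
    have h4 : (4:ℝ) ≤ 4 ^ n := by simpa using pow_le_pow_right₀ (by norm_num : (1:ℝ) ≤ 4) hn1
    have h8 : (8:ℝ) ^ n = 4 ^ n * 2 ^ n := by rw [← mul_pow]; norm_num
    have := Real.exp_one_lt_d9
    rw [h8]
    nlinarith
  have hlogpos : 0 < Real.log (Real.exp 1 + S / σ) := Real.log_pos (by
    have := Real.one_le_exp (zero_le_one (α := ℝ)); linarith)
  rcases (ENNReal.toReal_nonneg (a := μ (Metric.ball z σ))).eq_or_lt with h0 | hm
  · rw [← h0]; positivity
  set m := (μ (Metric.ball z σ)).toReal with hmdef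
  let Z : ℕ → ℝ := fun k =>
    ∫ q in Metric.ball z (2 ^ k * σ) ×ˢ Set.Ioo (0:ℝ) ((2 ^ k * σ / 2) ^ θ), u q.1 q.2 ^ p
  have hex : ∀ k : ℕ, ∃ a : ℝ, k < n → 0 ≤ a ∧ Z k + c * a ≤ Z (k+1) ∧ m + Z k + a ≤ C * a ^ (1/p) := by
    intro k
    by_cases hk : k < n
    · have hR : 0 < 2 ^ k * σ := by positivity
      obtain ⟨a, ha0, ha1, ha2⟩ := hstep T μ hμ u hu z (2 ^ k * σ) hR (by
        rw [← hST]; exact Real.rpow_lt_rpow hR.le (hnlt k hk) hθ0)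
      refine ⟨a, fun _ => ⟨ha0, ?_, ?_⟩⟩
      · have e1 : (2:ℝ) * (2 ^ k * σ) = 2 ^ (k+1) * σ := by ring
        have e2 : (2:ℝ) ^ k * σ = 2 ^ (k+1) * σ / 2 := by ring
        refine ha1.trans (le_of_eq ?_)
        simp only [Z]
        rw [e1, ← e2]
      · have : m ≤ μ.real (Metric.ball z (2 ^ k * σ)) := by
          refine measureReal_mono (Metric.ball_subset_ball ?_) measure_ball_lt_top.ne
          have : (1:ℝ) ≤ 2 ^ k := one_le_pow₀ (by norm_num)
          nlinarith
        simp only [Z]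
        linarith
    · exact ⟨0, fun h => absurd h hk⟩
  choose a ha using hex
  have hZ0 : 0 ≤ Z 0 := by
    refine setIntegral_nonneg (Metric.isOpen_ball.measurableSet.prod measurableSet_Ioo) fun q hq => ?_
    refine Real.rpow_nonneg (hu.2.1 _ _ ⟨hq.2.1, hq.2.2.trans ?_⟩) _
    rw [← hST]
    refine Real.rpow_lt_rpow (by positivity) ?_ hθ0
    simp only [pow_zero, one_mul]; linarith
  have key := aux_iter hp hC hc hc1 hm (n := n) hZ0 (fun k hk => (ha k hk).1)
    (fun k hk => (ha k hk).2.1) (fun k hk => (ha k hk).2.2)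
  rw [← hd] at key
  have hE : -(N:ℝ)/θ < 0 := by rw [neg_div]; simp only [Left.neg_neg_iff]; positivity
  calc m = (m ^ (-(p-1))) ^ (-(N:ℝ)/θ) := by
        rw [← Real.rpow_mul hm.le, hp1]
        have : -(θ / N) * (-(N:ℝ)/θ) = 1 := by field_simp
        rw [this, Real.rpow_one]
    _ ≤ (n * d) ^ (-(N:ℝ)/θ) := Real.rpow_le_rpow_of_nonpos (by positivity) key hE.le
    _ ≤ (d / Real.log 8 * Real.log (Real.exp 1 + S / σ)) ^ (-(N:ℝ)/θ) := by
        refine Real.rpow_le_rpow_of_nonpos (by positivity) ?_ hE.le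
        rw [div_mul_eq_mul_div, div_le_iff₀ hl8]
        nlinarith
    _ = _ := Real.mul_rpow (by positivity) hlogpos.le
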